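/- arXiv:2305.18833 — 2 statements merged into one kernel-verified Lean document; each statement's English description precedes it below -/
import Mathlib

section
/- (Proposition 3.3: the difference system for the auxiliary quantities.) For every integer n ≥ 1: (i) for every 1 ≤ j ≤ N, r_{n+1,j} = (t_j − (1/2)Σ_{k=1}^N R_{n,k})·R_{n,j} + γ_j − r_{n,j}; (ii) if R_{n−1,1} ≠ 0 then R_{n,1} = 2·r_{n,1}·(r_{n,1} − γ_1) / ((n + Σ_{k=1}^N r_{n,k})·R_{n−1,1}); (iii) for every 2 ≤ j ≤ N, if R_{n−1,j} ≠ 0 and r_{n,1}·(r_{n,1} − γ_1) ≠ 0, then R_{n,j} = (r_{n,j}(r_{n,j} − γ_j)/(r_{n,1}(r_{n,1} − γ_1)))·R_{n,1}·R_{n−1,1}/R_{n−1,j}. (Here n + Σ_k r_{n,k} = 2β_n > 0, so the denominator in (ii) is nonzero.) -/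
open MeasureTheory Polynomial

/-- The linear functional `Q ↦ ∫ Q g` on polynomials, for `g` with finite moments. -/
noncomputable def momentFunctional (g : ℝ → ℝ)
    (hg : ∀ Q : ℝ[X], Integrable fun x => Q.eval x * g x) : ℝ[X] →ₗ[ℝ] ℝ where
  toFun Q := ∫ x, Q.eval x * g x
  map_add' Q₁ Q₂ := by
    simp only [eval_add, add_mul]
    exact integral_add (hg Q₁) (hg Q₂)
  map_smul' c Q := by
    simp only [eval_smul, smul_eq_mul, mul_assoc, RingHom.id_apply]
    exact integral_const_mul c _

theorem momentFunctional_X_sub_C_mul {g : ℝ → ℝ} (t : ℝ)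
    (hg : ∀ Q : ℝ[X], Integrable fun x => Q.eval x * g x)
    (hg' : ∀ Q : ℝ[X], Integrable fun x => Q.eval x * (g x / (x - t))) (Q : ℝ[X]) :
    momentFunctional (fun x => g x / (x - t)) hg' ((X - C t) * Q) = momentFunctional g hg Q := by
  refine integral_congr_ae ?_
  filter_upwards [Measure.ae_ne volume t] with x hx
  have := sub_ne_zero.2 hx
  simp only [eval_mul, eval_sub, eval_X, eval_C]
  field_simp

section Algebra

theorem degree_sub_C_coeff_mul_monic_lt {p Q : ℝ[X]} {m : ℕ} (hp : p.Monic)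
    (hpm : p.natDegree = m) (hQ : Q.degree < (m + 1 : ℕ)) :
    (Q - C (Q.coeff m) * p).degree < m := by
  rw [degree_lt_iff_coeff_zero] at hQ ⊢
  intro k hk
  rcases hk.eq_or_lt with rfl | hk
  · have : p.coeff m = 1 := by rw [← hpm]; exact hp
    simp [this]
  · simp [hQ k hk, coeff_eq_zero_of_natDegree_lt (hpm.trans_lt hk)]

variable {L K : ℝ[X] →ₗ[ℝ] ℝ} {P : ℕ → ℝ[X]} (hP : ∀ n, (P n).Monic)
  (hPdeg : ∀ n, (P n).natDegree = n) (horth : ∀ m n, m ≠ n → L (P m * P n) = 0)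

theorem LinearMap.map_C_mul_poly (L : ℝ[X] →ₗ[ℝ] ℝ) (c : ℝ) (Q : ℝ[X]) :
    L (C c * Q) = c * L Q := by
  rw [← smul_eq_C_mul, map_smul, smul_eq_mul]

include hP hPdeg horth in
theorem orthogonal_mul_eq_zero {n : ℕ} {Q : ℝ[X]} (hQ : Q.degree < n) : L (P n * Q) = 0 := by
  suffices ∀ m ≤ n, ∀ Q : ℝ[X], Q.degree < m → L (P n * Q) = 0 from this n le_rfl Q hQ
  intro m
  induction m with
  | zero =>
    intro _ Q hQ
    have : Q = 0 := by simpa using hQ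
    simp [this]
  | succ m ih =>
    intro hm Q hQ
    have h := ih (by omega) _ (degree_sub_C_coeff_mul_monic_lt (hP m) (hPdeg m) hQ)
    rwa [mul_sub, map_sub, mul_left_comm, L.map_C_mul_poly, horth n m (by omega), mul_zero,
      sub_zero] at h

include hP hPdeg horth in
theorem orthogonal_mul_eq_coeff_mul {n : ℕ} {Q : ℝ[X]} (hQ : Q.natDegree ≤ n) :
    L (P n * Q) = Q.coeff n * L (P n * P n) := by
  have hlt : Q.degree < (n + 1 : ℕ) :=
    degree_le_natDegree.trans_lt (by exact_mod_cast Nat.lt_succ_of_le hQ)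
  have h := orthogonal_mul_eq_zero hP hPdeg horth
    (degree_sub_C_coeff_mul_monic_lt (hP n) (hPdeg n) hlt)
  rw [mul_sub, map_sub, mul_left_comm, L.map_C_mul_poly] at h
  linarith

include hP hPdeg horth in
theorem orthogonal_mul_monic {n : ℕ} {Q : ℝ[X]} (hQ : Q.natDegree = n) (hm : Q.Monic) :
    L (P n * Q) = L (P n * P n) := by
  have : Q.coeff n = 1 := by rw [← hQ]; exact hm
  rw [orthogonal_mul_eq_coeff_mul hP hPdeg horth hQ.le, this, one_mul]

include hP hPdeg horth in
theorem three_term_recurrence (hpos : ∀ n, L (P n * P n) ≠ 0) (n : ℕ) :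
    P (n + 2) = (X - C (L (X * (P (n + 1) * P (n + 1))) / L (P (n + 1) * P (n + 1)))) * P (n + 1) -
      C (L (P (n + 1) * P (n + 1)) / L (P n * P n)) * P n := by
  have hX : ∀ k, (X * P k).Monic ∧ (X * P k).natDegree = k + 1 := fun k =>
    ⟨monic_X.mul (hP k), by rw [natDegree_X_mul (hP k).ne_zero, hPdeg]⟩
  set a := L (X * (P (n + 1) * P (n + 1))) / L (P (n + 1) * P (n + 1)) with ha
  set b := L (P (n + 1) * P (n + 1)) / L (P n * P n) with hb
  set D := P (n + 2) - ((X - C a) * P (n + 1) - C b * P n) with hD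
  have key : ∀ k, L (P k * D) = 0 := by
    intro k
    have e : L (P k * D) = L (P k * P (n + 2)) - L (P (n + 1) * (X * P k)) +
        a * L (P k * P (n + 1)) + b * L (P k * P n) := by
      rw [← L.map_C_mul_poly, ← L.map_C_mul_poly, ← map_sub, ← map_add, ← map_add, hD]
      congr 1
      ring
    rw [e]
    rcases lt_or_ge k n with hk | hk
    · rw [horth k _ (by omega), horth k (n + 1) (by omega), horth k n (by omega),
        orthogonal_mul_eq_zero hP hPdeg horth]
      · simp
      · rw [degree_eq_natDegree (hX k).1.ne_zero, (hX k).2]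
        exact_mod_cast (by omega : k + 1 < n + 1)
    rcases hk.eq_or_lt with rfl | hk
    · rw [horth n _ (by omega), horth n (n + 1) (by omega),
        orthogonal_mul_monic hP hPdeg horth (hX n).2 (hX n).1, hb]
      field_simp [hpos n]
      ring
    rcases (Nat.succ_le_of_lt hk).eq_or_lt with rfl | hk
    · rw [horth _ (n + 2) (by simp), horth (n + 1) n (by simp), ha, Nat.succ_eq_add_one,
        mul_left_comm (P (n + 1)) X]
      field_simp [hpos (n + 1)]
      ring
    have hc : P (n + 1) * (X * P k) = P k * (X * P (n + 1)) := by ring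
    rw [horth k (n + 1) (by omega), horth k n (by omega), hc]
    rcases (Nat.succ_le_of_lt hk).eq_or_lt with rfl | hk
    · rw [orthogonal_mul_monic hP hPdeg horth (hX (n + 1)).2 (hX (n + 1)).1]
      ring
    · rw [horth k _ (by omega), orthogonal_mul_eq_zero hP hPdeg horth]
      · ring
      · rw [degree_eq_natDegree (hX _).1.ne_zero, (hX _).2]
        exact_mod_cast hk
  have h := orthogonal_mul_eq_coeff_mul hP hPdeg horth (le_refl D.natDegree)
  rw [key, eq_comm, mul_eq_zero, or_iff_left (hpos _), coeff_natDegree, leadingCoeff_eq_zero,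
    sub_eq_zero] at h
  exact h

theorem map_mul_eq_eval_mul_add_divByMonic {t : ℝ} (hK : ∀ Q, K ((X - C t) * Q) = L Q)
    (p q : ℝ[X]) : K (p * q) = q.eval t * K p + L (p * (q /ₘ (X - C t))) := by
  conv_lhs => rw [← modByMonic_add_div q (X - C t), modByMonic_X_sub_C_eq_C_eval]
  rw [mul_add, map_add, mul_comm p, K.map_C_mul_poly, mul_left_comm, hK]

include hP hPdeg horth in
theorem map_orthogonal_mul_of_natDegree_le {t : ℝ} (hK : ∀ Q, K ((X - C t) * Q) = L Q) {n : ℕ}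
    {q : ℝ[X]} (hq : q.natDegree ≤ n) : K (P n * q) = q.eval t * K (P n) := by
  rw [map_mul_eq_eval_mul_add_divByMonic hK, add_eq_left]
  by_cases h0 : q = 0
  · simp [h0]
  apply orthogonal_mul_eq_zero hP hPdeg horth
  refine (degree_divByMonic_lt _ _ h0 (by simp)).trans_le ?_
  exact degree_le_natDegree.trans (by exact_mod_cast hq)

include hP hPdeg horth in
theorem map_orthogonal_mul_monic_succ {t : ℝ} (hK : ∀ Q, K ((X - C t) * Q) = L Q) {n : ℕ}
    {q : ℝ[X]} (hq : q.natDegree = n + 1) (hm : q.Monic) :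
    K (P n * q) = q.eval t * K (P n) + L (P n * P n) := by
  rw [map_mul_eq_eval_mul_add_divByMonic hK, add_right_inj]
  apply orthogonal_mul_monic hP hPdeg horth
  · rw [natDegree_divByMonic _ (monic_X_sub_C t), hq, natDegree_X_sub_C, Nat.add_sub_cancel]
  · rw [Monic, leadingCoeff_divByMonic_X_sub_C _ _ t, hm]
    rw [degree_eq_natDegree hm.ne_zero, hq]
    simp
    exact_mod_cast n.succ_ne_zero

include hP hPdeg horth in
theorem map_mul_map_sub_eq {t : ℝ} (hK : ∀ Q, K ((X - C t) * Q) = L Q) (n : ℕ) :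
    K (P (n + 1) * P n) * (K (P (n + 1) * P n) - L (P n * P n)) =
      K (P (n + 1) * P (n + 1)) * K (P n * P n) := by
  have h₁ := map_orthogonal_mul_of_natDegree_le hP hPdeg horth hK (n := n + 1) (hPdeg _).le
  have h₂ := map_orthogonal_mul_of_natDegree_le hP hPdeg horth hK (n := n) (hPdeg _).le
  have h₃ := map_orthogonal_mul_of_natDegree_le hP hPdeg horth hK (n := n + 1) (q := P n)
    (by rw [hPdeg]; omega)
  have h₄ := map_orthogonal_mul_monic_succ hP hPdeg horth hK (hPdeg (n + 1)) (hP (n + 1))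
  rw [mul_comm (P n)] at h₄
  rw [h₁, h₂, h₄, add_sub_cancel_right, ← h₄, h₃]
  ring

include hP hPdeg horth in
theorem map_recurrence {t : ℝ} (hK : ∀ Q, K ((X - C t) * Q) = L Q)
    (hpos : ∀ n, L (P n * P n) ≠ 0) (n : ℕ) :
    K (P (n + 2) * P (n + 1)) = L (P (n + 1) * P (n + 1)) +
      (t - L (X * (P (n + 1) * P (n + 1))) / L (P (n + 1) * P (n + 1))) *
        K (P (n + 1) * P (n + 1)) -
      L (P (n + 1) * P (n + 1)) / L (P n * P n) * K (P (n + 1) * P n) := by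
  conv_lhs => rw [three_term_recurrence hP hPdeg horth hpos n]
  rw [← K.map_C_mul_poly, ← K.map_C_mul_poly, ← hK (P (n + 1) * P (n + 1)), ← map_add, ← map_sub]
  congr 1
  simp only [C_sub]
  ring

include hP hPdeg horth in
theorem sum_map_mul_self {ι : Type*} [Fintype ι] {γ : ι → ℝ} {K : ι → ℝ[X] →ₗ[ℝ] ℝ}
    (hibp : ∀ Q, L (derivative Q) - 2 * L (X * Q) + ∑ j, γ j * K j Q = 0) (n : ℕ) :
    ∑ j, γ j * K j (P n * P n) = 2 * L (X * (P n * P n)) := by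
  have h := hibp (P n * P n)
  have h0 : L (P n * derivative (P n)) = 0 := by
    apply orthogonal_mul_eq_zero hP hPdeg horth
    refine (degree_derivative_lt (hP n).ne_zero).trans_le ?_
    rw [degree_eq_natDegree (hP n).ne_zero, hPdeg]
  rw [derivative_mul, map_add, mul_comm, h0] at h
  linarith

include hP hPdeg horth in
theorem sum_map_mul_succ {ι : Type*} [Fintype ι] {γ : ι → ℝ} {K : ι → ℝ[X] →ₗ[ℝ] ℝ}
    (hibp : ∀ Q, L (derivative Q) - 2 * L (X * Q) + ∑ j, γ j * K j Q = 0) (n : ℕ) :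
    ∑ j, γ j * K j (P (n + 1) * P n) =
      2 * L (P (n + 1) * P (n + 1)) - (n + 1) * L (P n * P n) := by
  have h := hibp (P (n + 1) * P n)
  have h₁ : L (P (n + 1) * derivative (P n)) = 0 := by
    apply orthogonal_mul_eq_zero hP hPdeg horth
    refine (degree_derivative_lt (hP n).ne_zero).trans ?_
    rw [degree_eq_natDegree (hP n).ne_zero, hPdeg]
    exact_mod_cast n.lt_succ_self
  have h₂ : L (P n * derivative (P (n + 1))) = (n + 1) * L (P n * P n) := by
    rw [orthogonal_mul_eq_coeff_mul hP hPdeg horth, coeff_derivative]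
    · have : (P (n + 1)).coeff (n + 1) = 1 := by
        simpa only [Monic, leadingCoeff, hPdeg] using hP (n + 1)
      rw [this, one_mul]
    · exact (natDegree_derivative_le _).trans (by rw [hPdeg]; omega)
  have h₃ : L (X * (P (n + 1) * P n)) = L (P (n + 1) * P (n + 1)) := by
    rw [mul_left_comm]
    apply orthogonal_mul_monic hP hPdeg horth
    · rw [natDegree_X_mul (hP n).ne_zero, hPdeg]
    · exact monic_X.mul (hP n)
  rw [derivative_mul, map_add, mul_comm _ (P n), h₁, h₂, h₃] at h
  linarith

end Algebra

section Analysis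

open Filter Topology

theorem integral_eq_zero_of_hasDerivAt_off_finset {f f' : ℝ → ℝ} (s : Finset ℝ)
    (hf : Continuous f) (hd : ∀ x ∉ s, HasDerivAt f (f' x) x) (hfi : Integrable f)
    (hfi' : Integrable f') : ∫ x, f' x = 0 := by
  obtain ⟨b, hb⟩ := s.finite_toSet.bddAbove
  obtain ⟨a, ha⟩ := s.finite_toSet.bddBelow
  have htop : Tendsto f atTop (𝓝 0) :=
    tendsto_zero_of_hasDerivAt_of_integrableOn_Ioi (a := b)
      (fun x hx => hd x fun h => (hb h).not_gt hx) hfi'.integrableOn hfi.integrableOn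
  have hbot : Tendsto f atBot (𝓝 0) :=
    tendsto_zero_of_hasDerivAt_of_integrableOn_Iic (a := a - 1)
      (fun x hx => hd x fun h => (ha h).not_gt (lt_of_le_of_lt hx (sub_one_lt a)))
      hfi'.integrableOn hfi.integrableOn
  have h := intervalIntegral_tendsto_integral hfi' tendsto_neg_atTop_atBot tendsto_id
  refine tendsto_nhds_unique h ?_
  have h' : Tendsto (fun x => f x - f (-x)) atTop (𝓝 0) := by
    simpa using htop.sub (hbot.comp tendsto_neg_atTop_atBot)
  refine h'.congr' ?_
  filter_upwards [eventually_ge_atTop 0] with x hx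
  exact (integral_eq_of_hasDerivAt_off_countable_of_le f f' (by simp; linarith)
    s.countable_toSet hf.continuousOn (fun y hy => hd y hy.2) hfi'.intervalIntegrable).symm

theorem integrable_polynomial_mul_exp_neg_sq (Q : ℝ[X]) :
    Integrable fun x : ℝ => Q.eval x * Real.exp (-x ^ 2) := by
  induction Q using Polynomial.induction_on' with
  | add p q hp hq => 
    simp only [eval_add, add_mul]
    exact hp.add hq
  | monomial n a =>
    have h := integrable_rpow_mul_exp_neg_mul_sq one_pos (s := n)
      (neg_one_lt_zero.trans_le n.cast_nonneg)
    simpa [mul_assoc] using h.const_mul a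

variable {ι : Type*} [Fintype ι]

/-- The Gaussian weight multiplied by algebraic factors `|x - t j| ^ γ j`. -/
noncomputable def gaussianJacobiWeight (t γ : ι → ℝ) (x : ℝ) : ℝ :=
  Real.exp (-x ^ 2) * ∏ j, |x - t j| ^ γ j

variable {t γ : ι → ℝ} (hγ : ∀ j, 0 < γ j)

include hγ in
theorem continuous_gaussianJacobiWeight : Continuous (gaussianJacobiWeight t γ) := by
  refine (by fun_prop : Continuous fun x : ℝ => Real.exp (-x ^ 2)).mul
    (continuous_finsetProd _ fun j _ => ?_)
  exact (by fun_prop : Continuous fun x : ℝ => |x - t j|).rpow_const fun _ => Or.inr (hγ j).le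

theorem abs_rpow_le_one_add_sq_pow {s : ℝ} (hs : 0 ≤ s) (y : ℝ) :
    |y| ^ s ≤ (1 + y ^ 2) ^ ⌈s⌉₊ := by
  have h : |y| ≤ 1 + y ^ 2 := by nlinarith [sq_abs y, sq_nonneg (|y| - 1)]
  calc |y| ^ s ≤ (1 + y ^ 2) ^ s := Real.rpow_le_rpow (abs_nonneg y) h hs
    _ ≤ (1 + y ^ 2) ^ (⌈s⌉₊ : ℝ) :=
      Real.rpow_le_rpow_of_exponent_le (by nlinarith [sq_nonneg y]) (Nat.le_ceil s)
    _ = _ := Real.rpow_natCast _ _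

include hγ in
theorem integrable_polynomial_mul_weight (Q : ℝ[X]) :
    Integrable fun x => Q.eval x * gaussianJacobiWeight t γ x := by
  have h := integrable_polynomial_mul_exp_neg_sq
    (Q * ∏ j, (1 + (X - C (t j)) ^ 2) ^ ⌈γ j⌉₊)
  refine h.mono
    (Q.continuous.mul (continuous_gaussianJacobiWeight hγ)).aestronglyMeasurable
    (Eventually.of_forall fun x => ?_)
  have hle : ∏ j, |x - t j| ^ γ j ≤ ∏ j, (1 + (x - t j) ^ 2) ^ ⌈γ j⌉₊ :=
    Finset.prod_le_prod (fun _ _ => by positivity)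
      fun j _ => abs_rpow_le_one_add_sq_pow (hγ j).le _
  simp only [gaussianJacobiWeight, eval_mul, eval_prod, eval_pow, eval_add, eval_one, eval_sub,
    eval_X, eval_C, norm_mul]
  rw [mul_assoc, mul_comm ‖Real.exp _‖,
    Real.norm_of_nonneg (Finset.prod_nonneg fun _ _ => by positivity),
    Real.norm_of_nonneg (r := ∏ j, (1 + (x - t j) ^ 2) ^ ⌈γ j⌉₊) (by positivity)]
  gcongr

theorem locallyIntegrable_abs_rpow {s : ℝ} (hs : -1 < s) :
    LocallyIntegrable fun x : ℝ => |x| ^ s :=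
  locallyIntegrable_of_norm_le_rpow (C := 1) (α := -s) (by simp) (by simp; linarith)
    (Eventually.of_forall fun x => by
      simp [abs_of_nonneg (Real.rpow_nonneg (abs_nonneg x) s)])
    (by fun_prop : Measurable fun x : ℝ => |x| ^ s).aestronglyMeasurable

theorem abs_rpow_div_self {s : ℝ} (y : ℝ) : |(|y| ^ s / y)| ≤ |y| ^ (s - 1) := by
  rcases eq_or_ne y 0 with rfl | hy
  · simp [Real.rpow_nonneg]
  · rw [abs_div, Real.rpow_sub (abs_pos.2 hy), Real.rpow_one, abs_of_nonneg (by positivity)]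

include hγ in
theorem integrable_polynomial_mul_weight_div (Q : ℝ[X]) (j : ι) :
    Integrable fun x => Q.eval x * (gaussianJacobiWeight t γ x / (x - t j)) := by
  classical
  have hw := continuous_gaussianJacobiWeight (t := t) hγ
  have hmeas : AEStronglyMeasurable
      (fun x => Q.eval x * (gaussianJacobiWeight t γ x / (x - t j))) volume :=
    (Q.continuous.measurable.mul (hw.measurable.div (by fun_prop))).aestronglyMeasurable
  rw [← integrableOn_univ, ← Set.union_compl_self (Set.Icc (t j - 1) (t j + 1)),
    integrableOn_union]
  constructor
  · obtain ⟨g, hg⟩ : ∃ g : ℝ → ℝ, g = fun x =>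
      Q.eval x * (Real.exp (-x ^ 2) * ∏ i ∈ Finset.univ.erase j, |x - t i| ^ γ i) := ⟨_, rfl⟩
    have hgc : Continuous g := by
      rw [hg]
      exact Q.continuous.mul <| (by fun_prop : Continuous fun x : ℝ => Real.exp (-x ^ 2)).mul
        (continuous_finsetProd _ fun i _ =>
          (by fun_prop : Continuous fun x : ℝ => |x - t i|).rpow_const
            fun _ => Or.inr (hγ i).le)
    have h : IntegrableOn (fun x => g x * |x - t j| ^ (γ j - 1))
        (Set.Icc (t j - 1) (t j + 1)) := by
      refine IntegrableOn.continuousOn_mul hgc.continuousOn ?_ isCompact_Icc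
      rw [integrableOn_Icc_iff_integrableOn_Ioc,
        ← intervalIntegrable_iff_integrableOn_Ioc_of_le (by linarith)]
      have : IntervalIntegrable (fun x : ℝ => |x| ^ (γ j - 1)) volume (-1) 1 :=
        (intervalIntegrable_iff_integrableOn_Icc_of_le (by norm_num)).2 <|
          (locallyIntegrable_abs_rpow (by linarith [hγ j])).integrableOn_isCompact isCompact_Icc
      simpa [add_comm, sub_eq_add_neg] using this.comp_sub_right (t j)
    refine Integrable.mono h hmeas.restrict (Eventually.of_forall fun x => ?_)
    have e : Q.eval x * (gaussianJacobiWeight t γ x / (x - t j)) =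
        g x * (|x - t j| ^ γ j / (x - t j)) := by
      rw [hg, gaussianJacobiWeight, ← Finset.mul_prod_erase _ _ (Finset.mem_univ j)]
      ring
    rw [e, norm_mul, norm_mul, Real.norm_of_nonneg (r := |x - t j| ^ (γ j - 1)) (by positivity)]
    gcongr
    exact abs_rpow_div_self _
  · refine (integrable_polynomial_mul_weight (t := t) hγ Q).restrict.mono hmeas.restrict ?_
    filter_upwards [ae_restrict_mem measurableSet_Icc.compl] with x hx
    have hx' : 1 ≤ |x - t j| := by
      by_contra! h
      rw [abs_lt] at h
      exact hx ⟨by linarith, by linarith⟩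
    rw [norm_mul, norm_mul, norm_div]
    gcongr
    exact div_le_self (norm_nonneg _) hx'

theorem hasDerivAt_gaussianJacobiWeight {x : ℝ} (hx : ∀ j, x ≠ t j) :
    HasDerivAt (gaussianJacobiWeight t γ)
      (gaussianJacobiWeight t γ x * (-2 * x + ∑ j, γ j / (x - t j))) x := by
  have e : ∀ y, (∀ j, y ≠ t j) →
      gaussianJacobiWeight t γ y = Real.exp (-y ^ 2 + ∑ j, γ j * Real.log (y - t j)) := by
    intro y hy
    rw [Real.exp_add, Real.exp_sum, gaussianJacobiWeight]
    congr 1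
    refine Finset.prod_congr rfl fun j _ => ?_
    rw [Real.rpow_def_of_pos (abs_pos.2 (sub_ne_zero.2 (hy j))), Real.log_abs, mul_comm]
  have hev : ∀ᶠ y in 𝓝 x, ∀ j, y ≠ t j :=
    eventually_all.2 fun j => isOpen_ne.mem_nhds (hx j)
  have hd : HasDerivAt (fun y : ℝ => -y ^ 2 + ∑ j, γ j * Real.log (y - t j))
      (-2 * x + ∑ j, γ j / (x - t j)) x := by
    refine HasDerivAt.add ?_ (HasDerivAt.fun_sum fun j _ => ?_)
    · simpa using (hasDerivAt_pow 2 x).fun_neg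
    · simpa [div_eq_mul_inv] using
        (((hasDerivAt_id x).sub_const (t j)).log (sub_ne_zero.2 (hx j))).const_mul (γ j)
  rw [e x hx]
  exact hd.exp.congr_of_eventuallyEq (hev.mono e)

include hγ in
theorem integral_derivative_polynomial_mul_weight (Q : ℝ[X]) :
    (∫ x, (derivative Q).eval x * gaussianJacobiWeight t γ x) -
      2 * (∫ x, (X * Q).eval x * gaussianJacobiWeight t γ x) +
      ∑ j, γ j * ∫ x, Q.eval x * (gaussianJacobiWeight t γ x / (x - t j)) = 0 := by
  classical
  have h₁ := integrable_polynomial_mul_weight (t := t) hγ (derivative Q)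
  have h₂ := (integrable_polynomial_mul_weight (t := t) hγ (X * Q)).const_mul 2
  have h₃ : ∀ j ∈ Finset.univ, Integrable fun x =>
      γ j * (Q.eval x * (gaussianJacobiWeight t γ x / (x - t j))) := fun j _ =>
    (integrable_polynomial_mul_weight_div (t := t) hγ Q j).const_mul (γ j)
  simp only [← integral_const_mul]
  rw [← integral_sub h₁ h₂, ← integral_finsetSum _ h₃,
    ← integral_add (h₁.sub' h₂) (integrable_finsetSum _ h₃)]
  refine integral_eq_zero_of_hasDerivAt_off_finset (Finset.univ.image t)
    (Q.continuous.mul (continuous_gaussianJacobiWeight (t := t) hγ)) (fun x hx => ?_)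
    (integrable_polynomial_mul_weight hγ Q) ((h₁.sub h₂).add (integrable_finsetSum _ h₃))
  have hx' : ∀ j, x ≠ t j := fun j h => hx (by simp [h])
  refine ((Q.hasDerivAt x).mul (hasDerivAt_gaussianJacobiWeight (γ := γ) hx')).congr_deriv ?_
  symm
  rw [mul_add (gaussianJacobiWeight t γ x), mul_add (Q.eval x), Finset.mul_sum, Finset.mul_sum,
    ← add_assoc]
  congr 1
  · simp; ring
  · exact Finset.sum_congr rfl fun j _ => by ring

end Analysis

theorem difference_system
    (N : ℕ) (hN : 1 ≤ N)
    (t γ : Fin N → ℝ) (ht : Function.Injective t) (hγ : ∀ j, 0 < γ j)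
    (w : ℝ → ℝ) (hw : ∀ x : ℝ, w x = Real.exp (-x ^ 2) * ∏ j, |x - t j| ^ γ j)
    (P : ℕ → Polynomial ℝ)
    (hPmonic : ∀ n, (P n).Monic) (hPdeg : ∀ n, (P n).natDegree = n)
    (horth : ∀ m n, m ≠ n → ∫ x : ℝ, (P m).eval x * (P n).eval x * w x = 0)
    (h : ℕ → ℝ) (hh : ∀ n, h n = ∫ x : ℝ, ((P n).eval x) ^ 2 * w x)
    (hhpos : ∀ n, 0 < h n)
    (β : ℕ → ℝ) (hβ0 : β 0 = 0) (hβ : ∀ n, β (n + 1) = h (n + 1) / h n)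
    (α : ℕ → ℝ) (hα : ∀ n, α n = (∫ x : ℝ, x * ((P n).eval x) ^ 2 * w x) / h n)
    (R : ℕ → Fin N → ℝ)
    (hR : ∀ n j, R n j = γ j / h n * ∫ y : ℝ, ((P n).eval y) ^ 2 * w y / (y - t j))
    (r : ℕ → Fin N → ℝ) (hr0 : ∀ j, r 0 j = 0)
    (hr : ∀ n j, r (n + 1) j = γ j / h n * ∫ y : ℝ, (P (n + 1)).eval y * (P n).eval y * w y / (y - t j))
    (n : ℕ) (hn : 1 ≤ n) :
    (∀ j, r (n + 1) j = (t j - (1 / 2) * ∑ k, R n k) * R n j + γ j - r n j) ∧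
      (R (n - 1) ⟨0, hN⟩ ≠ 0 →
        R n ⟨0, hN⟩ = 2 * r n ⟨0, hN⟩ * (r n ⟨0, hN⟩ - γ ⟨0, hN⟩) /
          ((((n : ℝ) + ∑ k, r n k)) * R (n - 1) ⟨0, hN⟩)) ∧
      (∀ j : Fin N, j ≠ ⟨0, hN⟩ → R (n - 1) j ≠ 0 → r n ⟨0, hN⟩ * (r n ⟨0, hN⟩ - γ ⟨0, hN⟩) ≠ 0 →
        R n j = r n j * (r n j - γ j) / (r n ⟨0, hN⟩ * (r n ⟨0, hN⟩ - γ ⟨0, hN⟩)) *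
          R n ⟨0, hN⟩ * R (n - 1) ⟨0, hN⟩ / R (n - 1) j) := by
  obtain ⟨m, rfl⟩ : ∃ m, n = m + 1 := ⟨n - 1, by omega⟩
  have hw' : w = gaussianJacobiWeight t γ := funext hw
  have hint : ∀ Q : ℝ[X], Integrable fun x => Q.eval x * w x :=
    hw' ▸ integrable_polynomial_mul_weight hγ
  have hintK : ∀ j, ∀ Q : ℝ[X], Integrable fun x => Q.eval x * (w x / (x - t j)) :=
    fun j Q => hw' ▸ integrable_polynomial_mul_weight_div hγ Q j
  set L := momentFunctional w hint with hL
  set K := fun j => momentFunctional (fun x => w x / (x - t j)) (hintK j) with hKdef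
  have hibp : ∀ Q, L (derivative Q) - 2 * L (X * Q) + ∑ j, γ j * K j Q = 0 := fun Q => by
    subst hw'
    exact integral_derivative_polynomial_mul_weight hγ Q
  have hK : ∀ j Q, K j ((X - C (t j)) * Q) = L Q := fun j =>
    momentFunctional_X_sub_C_mul (t j) hint (hintK j)
  have hLorth : ∀ m n, m ≠ n → L (P m * P n) = 0 := fun m n hmn => by
    simpa [hL, momentFunctional] using horth m n hmn
  have hLh : ∀ n, L (P n * P n) = h n := fun n => by
    simp [hL, momentFunctional, hh, sq]
  have hL0 : ∀ n, L (P n * P n) ≠ 0 := fun n => hLh n ▸ (hhpos n).ne'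
  have hRK : ∀ n j, R n j = γ j / h n * K j (P n * P n) := fun n j => by
    simp [hKdef, momentFunctional, hR, sq, mul_div_assoc]
  have hrK : ∀ n j, r (n + 1) j = γ j / h n * K j (P (n + 1) * P n) := fun n j => by
    simp [hKdef, momentFunctional, hr, mul_div_assoc]
  have hm := (hhpos m).ne'
  have hm₁ := (hhpos (m + 1)).ne'
  have hsumR : ∑ k, R (m + 1) k = 2 * (L (X * (P (m + 1) * P (m + 1))) / h (m + 1)) := by
    rw [← mul_div_assoc, ← sum_map_mul_self hPmonic hPdeg hLorth hibp, Finset.sum_div]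
    exact Finset.sum_congr rfl fun k _ => by rw [hRK]; ring
  have hsumr : ((m + 1 : ℕ) : ℝ) + ∑ k, r (m + 1) k = 2 * (h (m + 1) / h m) := by
    have e : ∑ k, r (m + 1) k = (∑ k, γ k * K k (P (m + 1) * P m)) / h m := by
      rw [Finset.sum_div]
      exact Finset.sum_congr rfl fun k _ => by rw [hrK]; ring
    rw [e, sum_map_mul_succ hPmonic hPdeg hLorth hibp, hLh, hLh]
    push_cast
    field_simp
    ring
  have hprod : ∀ j, r (m + 1) j * (r (m + 1) j - γ j) =
      h (m + 1) / h m * R (m + 1) j * R m j := fun j => by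
    have e := map_mul_map_sub_eq hPmonic hPdeg hLorth (hK j) m
    rw [hLh] at e
    calc r (m + 1) j * (r (m + 1) j - γ j)
        = (γ j / h m) ^ 2 *
          (K j (P (m + 1) * P m) * (K j (P (m + 1) * P m) - h m)) := by
          rw [hrK]; field_simp
      _ = _ := by rw [e, hRK, hRK]; field_simp
  rw [Nat.add_sub_cancel]
  refine ⟨fun j => ?_, fun h0 => ?_, fun j _ hj h0 => ?_⟩
  · have e := map_recurrence hPmonic hPdeg hLorth (hK j) hL0 m
    rw [hLh, hLh] at e
    rw [hsumR, hrK (m + 1), hrK m, hRK, e]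
    field_simp
    ring
  · rw [hsumr, mul_assoc 2, hprod, eq_div_iff (by positivity)]
    ring
  · rw [hprod] at h0
    have h1 := right_ne_zero_of_mul h0
    have h2 := right_ne_zero_of_mul (left_ne_zero_of_mul h0)
    rw [hprod, hprod]
    field_simp
end

section
/- (Lemma 3.4: the sub-leading coefficient in terms of the auxiliary quantities.) For every integer n ≥ 1, if R_{n,j} ≠ 0 for every 1 ≤ j ≤ N, then p(n) = Σ_{j=1}^N t_j·r_{n,j} − (1/2)·(n + Σ_{j=1}^N r_{n,j})·Σ_{j=1}^N R_{n,j} − Σ_{j=1}^N (r_{n,j}² − γ_j·r_{n,j})/R_{n,j}. -/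
open MeasureTheory Polynomial

/-- A real function dominated by `C * exp (c * |x|)` for some constants `C` and `c`. -/
def HasExpGrowth (f : ℝ → ℝ) : Prop :=
  ∃ C c : ℝ, ∀ x, |f x| ≤ C * Real.exp (c * |x|)

namespace HasExpGrowth

theorem const (a : ℝ) : HasExpGrowth fun _ => a :=
  ⟨|a|, 0, fun x => by simp⟩

theorem mul {f g : ℝ → ℝ} (hf : HasExpGrowth f) (hg : HasExpGrowth g) :
    HasExpGrowth fun x => f x * g x := by
  obtain ⟨C, c, hC⟩ := hf
  obtain ⟨D, d, hD⟩ := hg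
  refine ⟨C * D, c + d, fun x => ?_⟩
  calc |f x * g x| = |f x| * |g x| := abs_mul _ _
    _ ≤ (C * Real.exp (c * |x|)) * (D * Real.exp (d * |x|)) :=
        mul_le_mul (hC x) (hD x) (abs_nonneg _) ((abs_nonneg _).trans (hC x))
    _ = C * D * Real.exp ((c + d) * |x|) := by rw [add_mul, Real.exp_add]; ring

theorem prod {ι : Type*} (s : Finset ι) {f : ι → ℝ → ℝ} (hf : ∀ i ∈ s, HasExpGrowth (f i)) :
    HasExpGrowth fun x => ∏ i ∈ s, f i x := by
  classical
  induction s using Finset.induction_on with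
  | empty => simpa using const 1
  | insert a s ha ih =>
    simp only [Finset.prod_insert ha]
    exact (hf a (Finset.mem_insert_self a s)).mul
      (ih fun i hi => hf i (Finset.mem_insert_of_mem hi))

theorem abs_sub_rpow (t : ℝ) {g : ℝ} (hg : 0 ≤ g) : HasExpGrowth fun x => |x - t| ^ g := by
  refine ⟨Real.exp (g * |t|), g, fun x => ?_⟩
  have hx : |x - t| ≤ Real.exp (|t| + |x|) := by
    have := Real.add_one_le_exp (|t| + |x|)
    have := abs_sub x t
    linarith
  rw [abs_of_nonneg (Real.rpow_nonneg (abs_nonneg _) _), ← Real.exp_add]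
  calc |x - t| ^ g ≤ Real.exp (|t| + |x|) ^ g := Real.rpow_le_rpow (abs_nonneg _) hx hg
    _ = Real.exp (g * |t| + g * |x|) := by rw [← Real.exp_mul]; ring_nf

theorem add {f g : ℝ → ℝ} (hf : HasExpGrowth f) (hg : HasExpGrowth g) :
    HasExpGrowth fun x => f x + g x := by
  obtain ⟨C, c, hC⟩ := hf
  obtain ⟨D, d, hD⟩ := hg
  refine ⟨|C| + |D|, max c d, fun x => ?_⟩
  have key (E e : ℝ) (he : e ≤ max c d) :
      E * Real.exp (e * |x|) ≤ |E| * Real.exp (max c d * |x|) := by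
    gcongr
    exact le_abs_self E
  calc |f x + g x| ≤ |f x| + |g x| := abs_add_le _ _
    _ ≤ (|C| + |D|) * Real.exp (max c d * |x|) := by
      rw [add_mul]
      exact add_le_add ((hC x).trans (key C c (le_max_left _ _)))
        ((hD x).trans (key D d (le_max_right _ _)))

theorem polynomial_eval (f : ℝ[X]) : HasExpGrowth fun x => f.eval x := by
  induction f using Polynomial.induction_on with
  | C a => simpa using const a
  | add p q hp hq => simpa using hp.add hq
  | monomial n a h =>
    have hX : HasExpGrowth fun x => x :=
      ⟨1, 1, fun x => by have := Real.add_one_le_exp |x|; rw [one_mul, one_mul]; linarith⟩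
    have := h.mul hX
    simp only [eval_mul, eval_C, eval_pow, eval_X] at this ⊢
    simpa only [pow_succ, mul_assoc] using this

theorem gaussian_bound {f : ℝ → ℝ} (hf : HasExpGrowth f) (t : ℝ) :
    ∃ C, ∀ x, |f x| * Real.exp (-x ^ 2) ≤ C * Real.exp (-(1 / 4) * (x - t) ^ 2) := by
  obtain ⟨C, c, hC⟩ := hf
  refine ⟨C * Real.exp (c ^ 2 / 2 + t ^ 2 / 2), fun x => ?_⟩
  have hC0 : 0 ≤ C := by simpa using (abs_nonneg _).trans (hC 0)
  calc |f x| * Real.exp (-x ^ 2) ≤ C * Real.exp (c * |x|) * Real.exp (-x ^ 2) := by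
        gcongr; exact hC x
    _ = C * Real.exp (c * |x| + -x ^ 2) := by rw [mul_assoc, ← Real.exp_add]
    _ ≤ C * Real.exp ((c ^ 2 / 2 + t ^ 2 / 2) + -(1 / 4) * (x - t) ^ 2) := by
        refine mul_le_mul_of_nonneg_left (Real.exp_le_exp.mpr ?_) hC0
        have h2 := sq_abs x
        nlinarith [sq_nonneg (|x| - c), sq_nonneg (x + t)]
    _ = _ := by rw [Real.exp_add]; ring

end HasExpGrowth

theorem integrable_abs_rpow_mul_exp_neg_mul_sq {b s : ℝ} (hb : 0 < b) (hs : -1 < s) :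
    Integrable fun x : ℝ => |x| ^ s * Real.exp (-b * x ^ 2) := by
  have hpos : IntegrableOn (fun x : ℝ => |x| ^ s * Real.exp (-b * x ^ 2)) (Set.Ioi 0) :=
    (integrableOn_rpow_mul_exp_neg_mul_sq hb hs).congr_fun
      (fun x hx => by simp only [abs_of_pos (Set.mem_Ioi.mp hx)]) measurableSet_Ioi
  have hneg : IntegrableOn (fun x : ℝ => |x| ^ s * Real.exp (-b * x ^ 2)) (Set.Iio 0) := by
    rw [← neg_zero] at hpos
    simpa only [abs_neg, neg_sq] using hpos.comp_neg_Iio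
  rw [← integrableOn_univ, ← Set.Iic_union_Ioi (a := (0 : ℝ)), integrableOn_union,
    integrableOn_Iic_iff_integrableOn_Iio]
  exact ⟨hneg, hpos⟩

section Weight

variable {ι : Type*} [Fintype ι]

/-- The Gaussian weight multiplied by the algebraic factors `|x - t j| ^ γ j`. -/
noncomputable def gaussianAlgWeight (t γ : ι → ℝ) (x : ℝ) : ℝ :=
  Real.exp (-x ^ 2) * ∏ j, |x - t j| ^ γ j

variable {t γ : ι → ℝ}

theorem continuous_gaussianAlgWeight (hγ : ∀ j, 0 < γ j) :
    Continuous (gaussianAlgWeight t γ) := by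
  unfold gaussianAlgWeight
  refine Continuous.mul (by fun_prop) (continuous_finsetProd _ fun j _ => ?_)
  exact Continuous.rpow_const (by fun_prop) fun _ => Or.inr (hγ j).le

theorem exists_abs_eval_mul_gaussianAlgWeight_le (hγ : ∀ j, 0 < γ j) (f : ℝ[X]) :
    ∃ C, ∀ x, |f.eval x * gaussianAlgWeight t γ x| ≤ C * Real.exp (-(1 / 4) * x ^ 2) := by
  obtain ⟨C, hC⟩ := ((HasExpGrowth.polynomial_eval f).mul (HasExpGrowth.prod Finset.univ
    fun j _ => HasExpGrowth.abs_sub_rpow (t j) (hγ j).le)).gaussian_bound 0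
  refine ⟨C, fun x => ?_⟩
  have := hC x
  rw [sub_zero] at this
  refine le_of_eq_of_le ?_ this
  rw [gaussianAlgWeight, abs_mul, abs_mul, abs_mul, abs_of_pos (Real.exp_pos _)]
  ring

theorem integrable_eval_mul_gaussianAlgWeight (hγ : ∀ j, 0 < γ j) (f : ℝ[X]) :
    Integrable fun x => f.eval x * gaussianAlgWeight t γ x := by
  obtain ⟨C, hC⟩ := exists_abs_eval_mul_gaussianAlgWeight_le (t := t) hγ f
  exact ((integrable_exp_neg_mul_sq (by norm_num : (0 : ℝ) < 1 / 4)).const_mul C).mono'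
    (f.continuous.mul (continuous_gaussianAlgWeight hγ)).aestronglyMeasurable
    (Filter.Eventually.of_forall hC)

theorem integrable_eval_mul_gaussianAlgWeight_div (hγ : ∀ j, 0 < γ j) (f : ℝ[X]) (j : ι) :
    Integrable fun x => f.eval x * gaussianAlgWeight t γ x / (x - t j) := by
  classical
  obtain ⟨C, hC⟩ := ((HasExpGrowth.polynomial_eval f).mul
    (HasExpGrowth.prod (Finset.univ.erase j)
      fun i _ => HasExpGrowth.abs_sub_rpow (t i) (hγ i).le)).gaussian_bound (t j)
  have hint := ((integrable_abs_rpow_mul_exp_neg_mul_sq (by norm_num : (0 : ℝ) < 1 / 4)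
    (by linarith [hγ j] : -1 < γ j - 1)).const_mul C).comp_sub_right (t j)
  refine hint.mono' ?_ (Filter.Eventually.of_forall fun x => ?_)
  · exact ((f.continuous.mul (continuous_gaussianAlgWeight hγ)).measurable.div
      (by fun_prop)).aestronglyMeasurable
  · have hC0 : 0 ≤ C := by
      have := hC (t j)
      simp only [sub_self] at this
      have h0 := (mul_nonneg (abs_nonneg _) (Real.exp_pos _).le).trans this
      simpa using h0
    by_cases hx : x - t j = 0
    · simp only [hx, div_zero, norm_zero]
      positivity
    · have hx' : 0 < |x - t j| := abs_pos.mpr hx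
      have hprod : (∏ i, |x - t i| ^ γ i) =
          |x - t j| ^ γ j * ∏ i ∈ Finset.univ.erase j, |x - t i| ^ γ i :=
        (Finset.mul_prod_erase _ _ (Finset.mem_univ j)).symm
      have hpos : 0 ≤ |x - t j| ^ (γ j - 1) := by positivity
      have := mul_le_mul_of_nonneg_left (hC x) hpos
      rw [Real.norm_eq_abs, gaussianAlgWeight, hprod]
      refine le_of_eq_of_le ?_ (this.trans_eq (by ring))
      rw [Real.rpow_sub_one hx'.ne', abs_div, abs_mul, abs_mul, abs_mul, abs_mul,
        abs_of_pos (Real.exp_pos _), abs_of_nonneg (by positivity : 0 ≤ |x - t j| ^ γ j)]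
      ring

theorem hasDerivAt_abs_sub_rpow {x a : ℝ} (g : ℝ) (hx : x ≠ a) :
    HasDerivAt (fun y => |y - a| ^ g) (g * |x - a| ^ g / (x - a)) x := by
  have hxa : x - a ≠ 0 := sub_ne_zero.mpr hx
  have h1 : HasDerivAt (fun y => |y - a|) (SignType.sign (x - a) : ℝ) x := by
    exact ((hasDerivAt_abs hxa).comp x ((hasDerivAt_id x).sub_const a)).congr_deriv (mul_one _)
  refine (h1.rpow_const (p := g) (Or.inl (abs_ne_zero.mpr hxa))).congr_deriv ?_
  rw [Real.rpow_sub_one (abs_ne_zero.mpr hxa)]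
  have hs : (SignType.sign (x - a) : ℝ) * (x - a) = |x - a| := sign_mul_self _
  have hne := abs_ne_zero.mpr hxa
  rw [eq_div_iff hxa]
  calc _ = (SignType.sign (x - a) * (x - a)) * (g * |x - a| ^ g) / |x - a| := by ring
    _ = _ := by rw [hs]; field_simp

theorem hasDerivAt_gaussianAlgWeight {x : ℝ} (hx : ∀ j, x ≠ t j) :
    HasDerivAt (gaussianAlgWeight t γ)
      (-(2 * x) * gaussianAlgWeight t γ x +
        ∑ j, γ j * (gaussianAlgWeight t γ x / (x - t j))) x := by
  classical
  have h1 : HasDerivAt (fun y : ℝ => Real.exp (-y ^ 2)) (Real.exp (-x ^ 2) * -(2 * x)) x := by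
    have := ((hasDerivAt_id x).pow 2).neg.exp
    simpa using this
  have h2 := HasDerivAt.fun_finsetProd (u := Finset.univ)
    fun j _ => hasDerivAt_abs_sub_rpow (γ j) (hx j)
  refine (h1.mul h2).congr_deriv ?_
  rw [gaussianAlgWeight, Finset.mul_sum]
  congr 1
  · ring
  · refine Finset.sum_congr rfl fun j _ => ?_
    rw [← Finset.mul_prod_erase _ (fun i => |x - t i| ^ γ i) (Finset.mem_univ j), smul_eq_mul]
    ring

theorem integral_eval_derivative_mul_gaussianAlgWeight (hγ : ∀ j, 0 < γ j) (f : ℝ[X]) :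
    ∫ x, (derivative f).eval x * gaussianAlgWeight t γ x =
      2 * (∫ x, (X * f).eval x * gaussianAlgWeight t γ x) -
        ∑ j, γ j * ∫ x, f.eval x * gaussianAlgWeight t γ x / (x - t j) := by
  set F : ℝ → ℝ := fun x => f.eval x * gaussianAlgWeight t γ x with hF
  set F' : ℝ → ℝ := fun x => ((derivative f).eval x * gaussianAlgWeight t γ x -
    2 * ((X * f).eval x * gaussianAlgWeight t γ x)) +
      ∑ j, γ j * (f.eval x * gaussianAlgWeight t γ x / (x - t j)) with hF'
  have i1 := integrable_eval_mul_gaussianAlgWeight (t := t) hγ (derivative f)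
  have i2 := (integrable_eval_mul_gaussianAlgWeight (t := t) hγ (X * f)).const_mul 2
  have i3 (j : ι) := (integrable_eval_mul_gaussianAlgWeight_div (t := t) hγ f j).const_mul (γ j)
  have i4 := integrable_finsetSum Finset.univ fun j _ => i3 j
  have hint : Integrable F' := (i1.sub i2).add i4
  have hFTC (n : ℕ) : ∫ x in -(n : ℝ)..n, F' x = F n - F (-n) := by
    refine integral_eq_of_hasDerivAt_off_countable F F' (s := Set.range t)
      (Set.countable_range t)
      (f.continuous.mul (continuous_gaussianAlgWeight hγ)).continuousOn
      (fun x hx => ?_) hint.intervalIntegrable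
    have hx' (j : ι) : x ≠ t j := fun h => hx.2 ⟨j, h.symm⟩
    refine ((f.hasDerivAt x).mul (hasDerivAt_gaussianAlgWeight hx')).congr_deriv ?_
    simp only [hF', eval_mul, eval_X, mul_add, Finset.mul_sum]
    rw [← add_assoc]
    congr 1
    · ring
    · exact Finset.sum_congr rfl fun j _ => by ring
  have hlim : Filter.Tendsto (fun n : ℕ => F n - F (-n)) Filter.atTop (nhds (0 - 0)) := by
    obtain ⟨C, hC⟩ := exists_abs_eval_mul_gaussianAlgWeight_le (t := t) hγ f
    have hexp : Filter.Tendsto (fun n : ℕ => C * Real.exp (-(1 / 4) * (n : ℝ) ^ 2))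
        Filter.atTop (nhds 0) := by
      rw [← mul_zero C]
      refine (Real.tendsto_exp_atBot.comp ?_).const_mul C
      exact ((Filter.tendsto_pow_atTop two_ne_zero).comp
        tendsto_natCast_atTop_atTop).const_mul_atTop_of_neg (by norm_num)
    refine (squeeze_zero_norm (fun n : ℕ => hC n) hexp).sub
      (squeeze_zero_norm (fun n : ℕ => (hC (-n)).trans_eq ?_) hexp)
    rw [neg_sq]
  have hlim' := intervalIntegral_tendsto_integral hint
    (Filter.tendsto_neg_atTop_atBot.comp tendsto_natCast_atTop_atTop)
    (tendsto_natCast_atTop_atTop (R := ℝ))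
  simp only [Function.comp_apply, hFTC] at hlim'
  have hzero := tendsto_nhds_unique hlim' hlim
  rw [hF', integral_add (i1.sub' i2) i4, integral_sub i1 i2, integral_const_mul,
    integral_finsetSum _ fun j _ => i3 j] at hzero
  simp only [integral_const_mul] at hzero
  linarith

theorem integral_X_sub_C_mul_eval_gaussianAlgWeight_div (f : ℝ[X]) (j : ι) :
    ∫ x, ((X - C (t j)) * f).eval x * gaussianAlgWeight t γ x / (x - t j) =
      ∫ x, f.eval x * gaussianAlgWeight t γ x := by
  refine integral_congr_ae ?_
  filter_upwards [(Set.countable_singleton (t j)).ae_notMem volume] with x hx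
  have : x - t j ≠ 0 := sub_ne_zero.mpr hx
  simp only [eval_mul, eval_sub, eval_X, eval_C]
  field_simp

end Weight

section OrthogonalPolynomials

variable {K : Type*} [Field K] {L : K[X] →ₗ[K] K} {P : ℕ → K[X]}

theorem monic_coeff_eq_one {p : K[X]} (hp : p.Monic) {n : ℕ} (hn : p.natDegree = n) :
    p.coeff n = 1 := by
  rw [← hn, hp.coeff_natDegree]

theorem degree_sub_C_coeff_mul_lt {p q : K[X]} (hp : p.Monic) {n : ℕ}
    (hn : p.natDegree = n) (hq : q.degree < (n + 1 : ℕ)) :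
    (q - C (q.coeff n) * p).degree < n := by
  rw [degree_lt_iff_coeff_zero] at hq ⊢
  intro k hk
  rw [coeff_sub, coeff_C_mul]
  rcases hk.eq_or_lt with rfl | hk
  · rw [monic_coeff_eq_one hp hn, mul_one, sub_self]
  · rw [hq k hk, coeff_eq_zero_of_natDegree_lt (hn.trans_lt hk), mul_zero, sub_zero]

theorem apply_orthogonal_mul_of_degree_lt (hPmonic : ∀ n, (P n).Monic)
    (hPdeg : ∀ n, (P n).natDegree = n) (horth : ∀ m n, m ≠ n → L (P m * P n) = 0)
    {n d : ℕ} (hd : d ≤ n) {q : K[X]} (hq : q.degree < d) : L (P n * q) = 0 := by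
  induction d generalizing q with
  | zero =>
    have : q = 0 := by simpa [Nat.WithBot.lt_zero_iff] using hq
    simp [this]
  | succ d ih =>
    have hlt := degree_sub_C_coeff_mul_lt (hPmonic d) (hPdeg d) hq
    have h0 := ih (by omega) hlt
    rw [mul_sub, map_sub, mul_left_comm, ← smul_eq_C_mul, map_smul, horth n d (by omega),
      smul_zero, sub_zero] at h0
    exact h0

theorem apply_orthogonal_mul (hPmonic : ∀ n, (P n).Monic)
    (hPdeg : ∀ n, (P n).natDegree = n) (horth : ∀ m n, m ≠ n → L (P m * P n) = 0)
    {n : ℕ} {q : K[X]} (hq : q.natDegree ≤ n) : L (P n * q) = q.coeff n * L (P n ^ 2) := by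
  have hlt := degree_sub_C_coeff_mul_lt (hPmonic n) (hPdeg n)
    (degree_le_natDegree.trans_lt (by exact_mod_cast Nat.lt_succ_of_le hq))
  have h0 := apply_orthogonal_mul_of_degree_lt hPmonic hPdeg horth le_rfl hlt
  rw [mul_sub, map_sub, mul_left_comm, ← smul_eq_C_mul, map_smul, ← sq, smul_eq_mul] at h0
  exact sub_eq_zero.mp h0

theorem apply_mul_eq_eval_mul_add {M : K[X] →ₗ[K] K} {a : K}
    (hM : ∀ f, M ((X - C a) * f) = L f) (p q : K[X]) :
    M (p * q) = q.eval a * M p + L (p * (q /ₘ (X - C a))) := by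
  have hq : q = (X - C a) * (q /ₘ (X - C a)) + C (q.eval a) := by
    rw [X_sub_C_mul_divByMonic_eq_sub_modByMonic, modByMonic_X_sub_C_eq_C_eval, sub_add_cancel]
  conv_lhs => rw [hq]
  rw [mul_add, map_add, mul_left_comm, hM, mul_comm p (C _), ← smul_eq_C_mul, map_smul,
    smul_eq_mul, add_comm]

theorem apply_divided_mul_identity (hPmonic : ∀ n, (P n).Monic)
    (hPdeg : ∀ n, (P n).natDegree = n) (horth : ∀ m n, m ≠ n → L (P m * P n) = 0)
    {M : K[X] →ₗ[K] K} {a : K} (hM : ∀ f, M ((X - C a) * f) = L f) (m : ℕ) :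
    M (P (m + 1) * P m) * (M (P (m + 1) * P m) - L (P m ^ 2)) =
      M (P (m + 1) ^ 2) * M (P m ^ 2) := by
  have hdeg (k : ℕ) : (P k /ₘ (X - C a)).natDegree = k - 1 := by
    rw [natDegree_divByMonic _ (monic_X_sub_C a), hPdeg, natDegree_X_sub_C]
  have hlt {k l : ℕ} (hkl : k ≤ l + 1) : (P k /ₘ (X - C a)).degree < (l + 1 : ℕ) :=
    degree_le_natDegree.trans_lt (by rw [hdeg]; exact_mod_cast (by omega : k - 1 < l + 1))
  have h1 : M (P (m + 1) ^ 2) = (P (m + 1)).eval a * M (P (m + 1)) := by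
    rw [sq, apply_mul_eq_eval_mul_add hM,
      apply_orthogonal_mul_of_degree_lt hPmonic hPdeg horth le_rfl (hlt le_rfl), add_zero]
  have h2 : M (P (m + 1) * P m) = (P m).eval a * M (P (m + 1)) := by
    rw [apply_mul_eq_eval_mul_add hM,
      apply_orthogonal_mul_of_degree_lt hPmonic hPdeg horth le_rfl (hlt (Nat.le_succ m)),
      add_zero]
  have h3 : M (P m ^ 2) = (P m).eval a * M (P m) := by
    rw [sq, apply_mul_eq_eval_mul_add hM]
    cases m with
    | zero =>
      rw [eq_one_of_monic_natDegree_zero (hPmonic 0) (hPdeg 0),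
        (divByMonic_eq_zero_iff (monic_X_sub_C a)).mpr (by simp)]
      simp
    | succ m =>
      rw [apply_orthogonal_mul_of_degree_lt hPmonic hPdeg horth le_rfl (hlt le_rfl), add_zero]
  have h4 : M (P (m + 1) * P m) = (P (m + 1)).eval a * M (P m) + L (P m ^ 2) := by
    have hcoeff : (P (m + 1) /ₘ (X - C a)).coeff m = 1 := by
      have hlead := leadingCoeff_divByMonic_of_monic (p := P (m + 1)) (monic_X_sub_C a)
        (by rw [degree_X_sub_C, degree_eq_natDegree (hPmonic _).ne_zero, hPdeg]
            exact_mod_cast (by omega : 1 ≤ m + 1))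
      rwa [leadingCoeff, hdeg, (hPmonic _).leadingCoeff] at hlead
    rw [mul_comm (P (m + 1)), apply_mul_eq_eval_mul_add hM,
      apply_orthogonal_mul hPmonic hPdeg horth (n := m) (hdeg (m + 1)).le, hcoeff, one_mul]
  rw [h1, h3]
  linear_combination (M (P (m + 1) * P m) - L (P m ^ 2)) * h2 +
    (P m).eval a * M (P (m + 1)) * h4

variable {ι : Type*} [Fintype ι] {M : ι → K[X] →ₗ[K] K} {t γ : ι → K}

theorem sum_apply_divided_sq (hPmonic : ∀ n, (P n).Monic)
    (hPdeg : ∀ n, (P n).natDegree = n) (horth : ∀ m n, m ≠ n → L (P m * P n) = 0)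
    (hparts : ∀ f, L (derivative f) = 2 * L (X * f) - ∑ j, γ j * M j f) (n : ℕ) :
    ∑ j, γ j * M j (P n ^ 2) = 2 * L (X * P n ^ 2) := by
  have h0 : L (P n * derivative (P n)) = 0 := by
    refine apply_orthogonal_mul_of_degree_lt hPmonic hPdeg horth le_rfl ?_
    have := degree_derivative_lt (hPmonic n).ne_zero
    rwa [degree_eq_natDegree (hPmonic n).ne_zero, hPdeg] at this
  have h1 := hparts (P n ^ 2)
  have h2 : derivative (P n ^ 2) = P n * derivative (P n) + P n * derivative (P n) := by
    rw [sq, derivative_mul]; ring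
  rw [h2, map_add, h0] at h1
  linear_combination h1

theorem sum_apply_divided_mul (hPmonic : ∀ n, (P n).Monic)
    (hPdeg : ∀ n, (P n).natDegree = n) (horth : ∀ m n, m ≠ n → L (P m * P n) = 0)
    (hparts : ∀ f, L (derivative f) = 2 * L (X * f) - ∑ j, γ j * M j f) (m : ℕ) :
    ∑ j, γ j * M j (P (m + 1) * P m) =
      2 * L (P (m + 1) ^ 2) - (m + 1) * L (P m ^ 2) := by
  have hc (k : ℕ) : (P k).coeff k = 1 := monic_coeff_eq_one (hPmonic k) (hPdeg k)
  have h1 : L (P m * derivative (P (m + 1))) = (m + 1) * L (P m ^ 2) := by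
    rw [apply_orthogonal_mul hPmonic hPdeg horth
      ((natDegree_derivative_le _).trans (by rw [hPdeg]; rfl)), coeff_derivative, hc, one_mul]
  have h2 : L (P (m + 1) * derivative (P m)) = 0 := by
    refine apply_orthogonal_mul_of_degree_lt hPmonic hPdeg horth (Nat.le_succ m) ?_
    have := degree_derivative_lt (hPmonic m).ne_zero
    rwa [degree_eq_natDegree (hPmonic m).ne_zero, hPdeg] at this
  have h3 : L (P (m + 1) * (X * P m)) = L (P (m + 1) ^ 2) := by
    rw [apply_orthogonal_mul hPmonic hPdeg horth
      (natDegree_mul_le.trans (by rw [hPdeg, natDegree_X]; omega)), coeff_X_mul, hc, one_mul]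
  have h4 := hparts (P (m + 1) * P m)
  rw [derivative_mul, map_add, mul_comm (derivative _), h1, h2, mul_left_comm, h3] at h4
  linear_combination h4

theorem apply_X_sq_mul (hPmonic : ∀ n, (P n).Monic)
    (hPdeg : ∀ n, (P n).natDegree = n) (horth : ∀ m n, m ≠ n → L (P m * P n) = 0) (m : ℕ) :
    L (P m ^ 2) * L (X * (X * (P (m + 1) * P m))) =
      L (P m ^ 2) * L (X * P (m + 1) ^ 2) + L (P (m + 1) ^ 2) * L (X * P m ^ 2) := by
  have hc (k : ℕ) : (P k).coeff k = 1 := monic_coeff_eq_one (hPmonic k) (hPdeg k)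
  set D := X * P m - P (m + 1) with hD
  have hDdeg : D.natDegree ≤ m := by
    rw [natDegree_le_iff_coeff_eq_zero]
    intro k hk
    obtain ⟨k, rfl⟩ : ∃ l, k = l + 1 := ⟨k - 1, by omega⟩
    rw [hD, coeff_sub, coeff_X_mul]
    rcases (Nat.lt_succ_iff.mp hk).eq_or_lt with rfl | hk
    · rw [hc, hc, sub_self]
    · rw [coeff_eq_zero_of_natDegree_lt (by rw [hPdeg]; exact hk),
        coeff_eq_zero_of_natDegree_lt (by rw [hPdeg]; omega), sub_zero]
  have h1 : L (P (m + 1) * (X * D)) = D.coeff m * L (P (m + 1) ^ 2) := by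
    rw [apply_orthogonal_mul hPmonic hPdeg horth
      (natDegree_mul_le.trans (by rw [natDegree_X]; omega)), coeff_X_mul]
  have h2 : L (P m * D) = D.coeff m * L (P m ^ 2) :=
    apply_orthogonal_mul hPmonic hPdeg horth hDdeg
  have h3 : L (X * (X * (P (m + 1) * P m))) = L (X * P (m + 1) ^ 2) + L (P (m + 1) * (X * D)) := by
    rw [← map_add]; congr 1; rw [hD]; ring
  have h4 : L (X * P m ^ 2) = L (P m * D) := by
    have : X * P m ^ 2 = P m * D + P m * P (m + 1) := by rw [hD]; ring
    rw [this, map_add, horth m (m + 1) (by omega), add_zero]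
  rw [h3, h4, h1, h2]
  ring

theorem coeff_mul_apply_sq (hPmonic : ∀ n, (P n).Monic)
    (hPdeg : ∀ n, (P n).natDegree = n) (horth : ∀ m n, m ≠ n → L (P m * P n) = 0)
    (hM : ∀ j f, M j ((X - C (t j)) * f) = L f)
    (hparts : ∀ f, L (derivative f) = 2 * L (X * f) - ∑ j, γ j * M j f) (m : ℕ) :
    (P (m + 1)).coeff m * L (P m ^ 2) =
      ∑ j, γ j * (t j * M j (P (m + 1) * P m)) - 2 * L (X * (X * (P (m + 1) * P m))) := by
  set E := X * derivative (P (m + 1)) - (m + 1 : K) • P (m + 1) with hE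
  have hcoeff (k : ℕ) : E.coeff k = (k - (m + 1)) * (P (m + 1)).coeff k := by
    rw [hE, coeff_sub, coeff_smul, smul_eq_mul]
    cases k with
    | zero => simp; ring
    | succ k => rw [coeff_X_mul, coeff_derivative]; push_cast; ring
  have hEdeg : E.natDegree ≤ m := by
    rw [natDegree_le_iff_coeff_eq_zero]
    intro k hk
    rw [hcoeff]
    rcases (Nat.succ_le_of_lt hk).eq_or_lt with rfl | hk
    · push_cast; ring
    · rw [coeff_eq_zero_of_natDegree_lt (by rw [hPdeg]; exact hk), mul_zero]
  have h1 : L (P m * E) = -((P (m + 1)).coeff m * L (P m ^ 2)) := by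
    rw [apply_orthogonal_mul hPmonic hPdeg horth hEdeg, hcoeff]; ring
  have h2 : L (P (m + 1) * (X * derivative (P m))) = 0 := by
    refine apply_orthogonal_mul_of_degree_lt hPmonic hPdeg horth le_rfl
      (degree_lt_iff_coeff_zero _ _ |>.mpr fun k hk => ?_)
    obtain ⟨k, rfl⟩ : ∃ l, k = l + 1 := ⟨k - 1, by omega⟩
    rw [coeff_X_mul, coeff_derivative,
      coeff_eq_zero_of_natDegree_lt (by rw [hPdeg]; omega), zero_mul]
  have h3 : derivative (X * (P (m + 1) * P m)) = P m * E + P (m + 1) * (X * derivative (P m))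
      + (m + 2 : K) • (P (m + 1) * P m) := by
    rw [hE]
    simp only [derivative_mul, derivative_X, smul_eq_C_mul, C_add, C_1, map_natCast, C_ofNat]
    ring
  have h4 (j : ι) : M j (X * (P (m + 1) * P m)) = t j * M j (P (m + 1) * P m) := by
    have := hM j (P (m + 1) * P m)
    rw [horth _ _ (by omega), sub_mul, map_sub, ← smul_eq_C_mul, map_smul, smul_eq_mul] at this
    exact sub_eq_zero.mp this
  have h5 := hparts (X * (P (m + 1) * P m))
  rw [h3, map_add, map_add, h1, h2, map_smul, horth _ _ (by omega), smul_zero] at h5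
  simp only [h4] at h5
  linear_combination -h5

end OrthogonalPolynomials

section Weight

variable {ι : Type*} [Fintype ι] {t γ : ι → ℝ}

/-- Integration of polynomials against `gaussianAlgWeight t γ`. -/
noncomputable def gaussianAlgMoment (hγ : ∀ j, 0 < γ j) (t : ι → ℝ) : ℝ[X] →ₗ[ℝ] ℝ where
  toFun f := ∫ x, f.eval x * gaussianAlgWeight t γ x
  map_add' f g := by
    simp only [eval_add, add_mul]
    exact integral_add (integrable_eval_mul_gaussianAlgWeight hγ f)
      (integrable_eval_mul_gaussianAlgWeight hγ g)
  map_smul' c f := by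
    simp only [eval_smul, smul_eq_mul, mul_assoc, RingHom.id_apply]
    exact integral_const_mul _ _

/-- Integration of polynomials against `gaussianAlgWeight t γ x / (x - t j)`. -/
noncomputable def gaussianAlgDividedMoment (hγ : ∀ j, 0 < γ j) (t : ι → ℝ) (j : ι) :
    ℝ[X] →ₗ[ℝ] ℝ where
  toFun f := ∫ x, f.eval x * gaussianAlgWeight t γ x / (x - t j)
  map_add' f g := by
    simp only [eval_add, add_mul, add_div]
    exact integral_add (integrable_eval_mul_gaussianAlgWeight_div hγ f j)
      (integrable_eval_mul_gaussianAlgWeight_div hγ g j)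
  map_smul' c f := by
    simp only [eval_smul, smul_eq_mul, mul_assoc, mul_div_assoc, RingHom.id_apply]
    exact integral_const_mul _ _

end Weight

theorem subleading_coeff
    (N : ℕ) (hN : 1 ≤ N)
    (t γ : Fin N → ℝ) (ht : Function.Injective t) (hγ : ∀ j, 0 < γ j)
    (w : ℝ → ℝ) (hw : ∀ x : ℝ, w x = Real.exp (-x ^ 2) * ∏ j, |x - t j| ^ γ j)
    (P : ℕ → Polynomial ℝ)
    (hPmonic : ∀ n, (P n).Monic) (hPdeg : ∀ n, (P n).natDegree = n)
    (horth : ∀ m n, m ≠ n → ∫ x : ℝ, (P m).eval x * (P n).eval x * w x = 0)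
    (h : ℕ → ℝ) (hh : ∀ n, h n = ∫ x : ℝ, ((P n).eval x) ^ 2 * w x)
    (hhpos : ∀ n, 0 < h n)
    (β : ℕ → ℝ) (hβ0 : β 0 = 0) (hβ : ∀ n, β (n + 1) = h (n + 1) / h n)
    (α : ℕ → ℝ) (hα : ∀ n, α n = (∫ x : ℝ, x * ((P n).eval x) ^ 2 * w x) / h n)
    (R : ℕ → Fin N → ℝ)
    (hR : ∀ n j, R n j = γ j / h n * ∫ y : ℝ, ((P n).eval y) ^ 2 * w y / (y - t j))
    (r : ℕ → Fin N → ℝ) (hr0 : ∀ j, r 0 j = 0)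
    (hr : ∀ n j, r (n + 1) j = γ j / h n * ∫ y : ℝ, (P (n + 1)).eval y * (P n).eval y * w y / (y - t j))
    (p : ℕ → ℝ) (hp0 : p 0 = 0) (hp : ∀ n, p (n + 1) = (P (n + 1)).coeff n)
    (n : ℕ) (hn : 1 ≤ n) (hRne : ∀ j, R n j ≠ 0) :
    p n = (∑ j, t j * r n j) - (1 / 2) * (((n : ℝ) + ∑ j, r n j) * (∑ j, R n j))
        - ∑ j, ((r n j) ^ 2 - γ j * r n j) / R n j := by
  obtain ⟨m, rfl⟩ : ∃ m, n = m + 1 := ⟨n - 1, by omega⟩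
  obtain rfl : w = gaussianAlgWeight t γ := funext hw
  set L := gaussianAlgMoment hγ t
  set M := gaussianAlgDividedMoment hγ t
  have horthL (k l : ℕ) (hkl : k ≠ l) : L (P k * P l) = 0 := by
    rw [← horth k l hkl]
    simp only [← eval_mul]
    rfl
  have hhL (k : ℕ) : h k = L (P k ^ 2) := by
    rw [hh]
    simp only [← eval_pow]
    rfl
  have hRM (k : ℕ) (j : Fin N) : R k j = γ j / h k * M j (P k ^ 2) := by
    rw [hR]
    simp only [← eval_pow]
    rfl
  have hrM (j : Fin N) : r (m + 1) j = γ j / h m * M j (P (m + 1) * P m) := by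
    rw [hr]
    simp only [← eval_mul]
    rfl
  have hM (j : Fin N) (f : ℝ[X]) : M j ((X - C (t j)) * f) = L f :=
    integral_X_sub_C_mul_eval_gaussianAlgWeight_div f j
  have hparts (f : ℝ[X]) : L (derivative f) = 2 * L (X * f) - ∑ j, γ j * M j f :=
    integral_eval_derivative_mul_gaussianAlgWeight hγ f
  have hm := (hhpos m).ne'
  have hn' := (hhpos (m + 1)).ne'
  have hsumR (k : ℕ) : ∑ j, R k j = 2 * L (X * P k ^ 2) / h k := by
    rw [← sum_apply_divided_sq hPmonic hPdeg horthL hparts k, Finset.sum_div]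
    exact Finset.sum_congr rfl fun j _ => by rw [hRM]; ring
  have hsumr : ∑ j, r (m + 1) j = 2 * h (m + 1) / h m - (m + 1) := by
    have := sum_apply_divided_mul hPmonic hPdeg horthL hparts m
    rw [← hhL, ← hhL] at this
    calc _ = (∑ j, γ j * M j (P (m + 1) * P m)) / h m := by
          rw [Finset.sum_div]
          exact Finset.sum_congr rfl fun j _ => by rw [hrM]; ring
      _ = _ := by rw [this]; field_simp
  have hquot (j : Fin N) : (r (m + 1) j ^ 2 - γ j * r (m + 1) j) / R (m + 1) j =
      h (m + 1) / h m * R m j := by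
    have := apply_divided_mul_identity hPmonic hPdeg horthL (hM j) m
    rw [← hhL] at this
    rw [div_eq_iff (hRne j), hrM, hRM, hRM]
    field_simp
    linear_combination (γ j) ^ 2 * this
  have hsumtr : ∑ j, t j * r (m + 1) j =
      (∑ j, γ j * (t j * M j (P (m + 1) * P m))) / h m := by
    rw [Finset.sum_div]
    exact Finset.sum_congr rfl fun j _ => by rw [hrM]; ring
  have hcoeff := coeff_mul_apply_sq hPmonic hPdeg horthL hM hparts m
  generalize ∑ j, γ j * (t j * M j (P (m + 1) * P m)) = S at hcoeff hsumtr
  have hXX := apply_X_sq_mul hPmonic hPdeg horthL m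
  rw [← hhL] at hcoeff
  rw [← hhL, ← hhL] at hXX
  rw [Finset.sum_congr rfl fun j _ => hquot j, ← Finset.mul_sum, hsumR, hsumR, hsumr, hsumtr,
    hp]
  push_cast
  field_simp
  linear_combination h m * h (m + 1) * hcoeff - 2 * h (m + 1) * hXX
end
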